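/- arXiv:2103.04592 — 10 statements merged into one kernel-verified Lean document; each statement's English description precedes it below -/
import Mathlib

section
/- Implicit Duality Theorem: Let S, P, Q be pairwise disjoint finite sets and let V_SP, V_PQ be vector spaces on S⊎P and P⊎Q over a field F. Then (V_SP ↔ V_PQ)⊥ = V_SP⊥ ⇌ V_PQ⊥. In particular, for Q = ∅ and any vector space V_P on P, (V_SP ↔ V_P)⊥ = V_SP⊥ ↔ V_P⊥. -/
namespace ILA

variable {F : Type*} [Field F]

/-- Restriction of a collection on `X ⊎ Y` to its left component `X`. -/
def restrL {X Y : Type*} (K : Set (X ⊕ Y → F)) : Set (X → F) :=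
  {f | ∃ g : Y → F, Sum.elim f g ∈ K}

/-- Contraction of a collection on `X ⊎ Y` to its left component `X`. -/
def contrL {X Y : Type*} (K : Set (X ⊕ Y → F)) : Set (X → F) :=
  {f | Sum.elim f (0 : Y → F) ∈ K}

/-- Restriction of a collection on `X ⊎ Y` to its right component `Y`. -/
def restrR {X Y : Type*} (K : Set (X ⊕ Y → F)) : Set (Y → F) :=
  {g | ∃ f : X → F, Sum.elim f g ∈ K}

/-- Contraction of a collection on `X ⊎ Y` to its right component `Y`. -/
def contrR {X Y : Type*} (K : Set (X ⊕ Y → F)) : Set (Y → F) :=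
  {g | Sum.elim (0 : X → F) g ∈ K}

/-- Matched composition of a collection on `S ⊎ P` with one on `P ⊎ Q`. -/
def matched {S P Q : Type*} (K₁ : Set (S ⊕ P → F)) (K₂ : Set (P ⊕ Q → F)) :
    Set (S ⊕ Q → F) :=
  {h | ∃ p : P → F, Sum.elim (h ∘ Sum.inl) p ∈ K₁ ∧ Sum.elim p (h ∘ Sum.inr) ∈ K₂}

/-- Skewed composition of a collection on `S ⊎ P` with one on `P ⊎ Q`. -/
def skewed {S P Q : Type*} (K₁ : Set (S ⊕ P → F)) (K₂ : Set (P ⊕ Q → F)) :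
    Set (S ⊕ Q → F) :=
  {h | ∃ p : P → F, Sum.elim (h ∘ Sum.inl) p ∈ K₁ ∧ Sum.elim (-p) (h ∘ Sum.inr) ∈ K₂}

/-- Matched composition of a collection on `S ⊎ P` with one on `P` (i.e. `Q = ∅`). -/
def matchedP {S P : Type*} (K₁ : Set (S ⊕ P → F)) (K₂ : Set (P → F)) : Set (S → F) :=
  {f | ∃ p ∈ K₂, Sum.elim f p ∈ K₁}

/-- Matched composition over the common left component `S` of collections on
`S ⊎ P` and `S ⊎ Q`; the result lives on `P ⊎ Q`. -/
def matchedL {S P Q : Type*} (K₁ : Set (S ⊕ P → F)) (K₂ : Set (S ⊕ Q → F)) :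
    Set (P ⊕ Q → F) :=
  {h | ∃ s : S → F, Sum.elim s (h ∘ Sum.inl) ∈ K₁ ∧ Sum.elim s (h ∘ Sum.inr) ∈ K₂}

/-- The collection of vectors orthogonal (w.r.t. the standard dot product)
to every vector of `K`. -/
def dualSet {X : Type*} [Fintype X] (K : Set (X → F)) : Set (X → F) :=
  {g | ∀ f ∈ K, ∑ x, f x * g x = 0}

/-- The coset `a + K`. -/
def coset {X : Type*} (a : X → F) (K : Set (X → F)) : Set (X → F) :=
  {v | ∃ u ∈ K, v = a + u}

/-- Rank of a collection of vectors: the dimension of its span. -/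
noncomputable def rk {X : Type*} (K : Set (X → F)) : ℕ :=
  Module.finrank F (Submodule.span F K)

/-- `R + L` is everything: the full sum property for a pair of collections on `Y`. -/
def FullSumSets {Y : Type*} (R L : Set (Y → F)) : Prop :=
  ∀ h : Y → F, ∃ u ∈ R, ∃ v ∈ L, h = u + v

/-- The vector on `S ⊎ P ⊎ Q` assembled from its three components. -/
def triple {S P Q : Type*} (f : S → F) (p : P → F) (g : Q → F) : S ⊕ (P ⊕ Q) → F :=
  Sum.elim f (Sum.elim p g)

/-- Extended sum of collections on `S ⊎ P` and `P ⊎ Q`, living on `S ⊎ P ⊎ Q`. -/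
def extSum {S P Q : Type*} (K₁ : Set (S ⊕ P → F)) (K₂ : Set (P ⊕ Q → F)) :
    Set (S ⊕ (P ⊕ Q) → F) :=
  {v | ∃ (f : S → F) (p₁ p₂ : P → F) (g : Q → F),
    Sum.elim f p₁ ∈ K₁ ∧ Sum.elim p₂ g ∈ K₂ ∧ v = triple f (p₁ + p₂) g}

/-- Extended intersection of collections on `S ⊎ P` and `P ⊎ Q`, living on `S ⊎ P ⊎ Q`. -/
def extInter {S P Q : Type*} (K₁ : Set (S ⊕ P → F)) (K₂ : Set (P ⊕ Q → F)) :
    Set (S ⊕ (P ⊕ Q) → F) :=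
  {v | ∃ (f : S → F) (p : P → F) (g : Q → F),
    Sum.elim f p ∈ K₁ ∧ Sum.elim p g ∈ K₂ ∧ v = triple f p g}

/-- Restriction of a collection on `S ⊎ P ⊎ Q` to `S ⊎ Q`. -/
def restrSQ {S P Q : Type*} (K : Set (S ⊕ (P ⊕ Q) → F)) : Set (S ⊕ Q → F) :=
  {w | ∃ p : P → F, triple (w ∘ Sum.inl) p (w ∘ Sum.inr) ∈ K}

/-- Contraction of a collection on `S ⊎ P ⊎ Q` to `S ⊎ Q`. -/
def contrSQ {S P Q : Type*} (K : Set (S ⊕ (P ⊕ Q) → F)) : Set (S ⊕ Q → F) :=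
  {w | triple (w ∘ Sum.inl) (0 : P → F) (w ∘ Sum.inr) ∈ K}

/-- `K_{(−P)Q}`: negate the `P`-components of all vectors of `K`. -/
def negL {P Q : Type*} (K : Set (P ⊕ Q → F)) : Set (P ⊕ Q → F) :=
  {v | Sum.elim (-(v ∘ Sum.inl)) (v ∘ Sum.inr) ∈ K}

/-- Direct sum of collections on `X` and on `Y`, living on `X ⊎ Y`. -/
def dsum {X Y : Type*} (K₁ : Set (X → F)) (K₂ : Set (Y → F)) : Set (X ⊕ Y → F) :=
  {h | h ∘ Sum.inl ∈ K₁ ∧ h ∘ Sum.inr ∈ K₂}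

/-- Matched composition of a collection on `W ⊎ T ⊎ V` with one on `V`,
yielding a collection on `W ⊎ T`. -/
def matchedTriple {W T V : Type*} (K : Set (W ⊕ (T ⊕ V) → F)) (L : Set (V → F)) :
    Set (W ⊕ T → F) :=
  {w | ∃ g ∈ L, Sum.elim (w ∘ Sum.inl) (Sum.elim (w ∘ Sum.inr) g) ∈ K}

/-- Extended sum of a collection on `W ⊎ T ⊎ V` with one on `V`. -/
def extSumV {W T V : Type*} (K : Set (W ⊕ (T ⊕ V) → F)) (L : Set (V → F)) :
    Set (W ⊕ (T ⊕ V) → F) :=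
  {v | ∃ u ∈ K, ∃ g ∈ L, v = u + Sum.elim (0 : W → F) (Sum.elim (0 : T → F) g)}

/-- Extended intersection of a collection on `W ⊎ T ⊎ V` with one on `V`. -/
def extInterV {W T V : Type*} (K : Set (W ⊕ (T ⊕ V) → F)) (L : Set (V → F)) :
    Set (W ⊕ (T ⊕ V) → F) :=
  {v | v ∈ K ∧ (fun x => v (Sum.inr (Sum.inr x))) ∈ L}

/-- Restriction of a collection on `W ⊎ T ⊎ V` to `T`. -/
def restrT {W T V : Type*} (K : Set (W ⊕ (T ⊕ V) → F)) : Set (T → F) :=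
  {t | ∃ (w : W → F) (v : V → F), Sum.elim w (Sum.elim t v) ∈ K}

/-- Contraction of a collection on `W ⊎ T ⊎ V` to `T`. -/
def contrT {W T V : Type*} (K : Set (W ⊕ (T ⊕ V) → F)) : Set (T → F) :=
  {t | Sum.elim (0 : W → F) (Sum.elim t (0 : V → F)) ∈ K}

/-- The image of a collection on `Y ⊎ Y` under the coordinate swap. -/
def swapSet {Y : Type*} (K : Set (Y ⊕ Y → F)) : Set (Y ⊕ Y → F) :=
  (fun v => Sum.elim (v ∘ Sum.inr) (v ∘ Sum.inl)) '' K

/-- A collection on `Y ⊎ Y` is Dirac iff its swap equals its orthogonal complement. -/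
def IsDirac {Y : Type*} [Fintype Y] (K : Set (Y ⊕ Y → F)) : Prop :=
  swapSet K = dualSet K

/-- `T` is column-independent in `K`: the only vector orthogonal to `K` and
supported inside `T` is zero. -/
def ColIndep {X : Type*} [Fintype X] (K : Set (X → F)) (T : Set X) : Prop :=
  ∀ g ∈ dualSet K, (∀ x ∉ T, g x = 0) → g = 0

/-- `T` is a column base of `K`: a column-independent set of size `rk K`. -/
def IsColBase {X : Type*} [Fintype X] (K : Set (X → F)) (T : Set X) : Prop :=
  ColIndep K T ∧ T.ncard = rk K


/-- The orthogonal complement of an intersection of subspaces lies in the sum of the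
orthogonal complements. -/
lemma exists_add_of_mem_dualSet_inf {X : Type*} [Fintype X] (U W : Submodule F (X → F))
    {g : X → F} (hg : g ∈ dualSet ((U ⊓ W : Submodule F (X → F)) : Set (X → F))) :
    ∃ a ∈ dualSet (U : Set (X → F)), ∃ b ∈ dualSet (W : Set (X → F)), a + b = g := by
  classical
  have hdual : ∀ (φ : Module.Dual F (X → F)) (f : X → F),
      ∑ x, f x * φ (Pi.single x 1) = φ f := fun φ f => by
    conv_rhs => rw [← (dotProductEquiv F X).apply_symm_apply φ]
    simp only [dotProductEquiv_apply_apply, dotProductEquiv_symm_apply, dotProduct, mul_comm,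
      LinearMap.single_apply]
  have hann : dotProductEquiv F X g ∈ U.dualAnnihilator ⊔ W.dualAnnihilator := by
    rw [← Subspace.dualAnnihilator_inf_eq, Submodule.mem_dualAnnihilator]
    intro f hf
    simpa [dotProduct, mul_comm] using hg f hf
  obtain ⟨φ, hφ, ψ, hψ, hadd⟩ := Submodule.mem_sup.mp hann
  rw [Submodule.mem_dualAnnihilator] at hφ hψ
  refine ⟨fun x => φ (Pi.single x 1), fun f hf => (hdual φ f).trans (hφ f hf),
    fun x => ψ (Pi.single x 1), fun f hf => (hdual ψ f).trans (hψ f hf), ?_⟩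
  ext x
  simpa using LinearMap.congr_fun hadd (Pi.single x 1)

/-- A vector orthogonal to the cylinder over `V` along an injection `i` vanishes off the
range of `i`. -/
lemma eq_zero_of_mem_dualSet_comap {X Y : Type*} [Fintype Y] {i : X → Y}
    {V : Submodule F (X → F)} {a : Y → F}
    (ha : a ∈ dualSet (V.comap (LinearMap.funLeft F F i) : Set (Y → F)))
    {y : Y} (hy : y ∉ Set.range i) : a y = 0 := by
  classical
  have hmem : (Pi.single y 1 : Y → F) ∈ V.comap (LinearMap.funLeft F F i) := by
    have hzero : LinearMap.funLeft F F i (Pi.single y 1) = 0 := by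
      ext x
      exact Pi.single_eq_of_ne (fun h => hy ⟨x, h⟩) 1
    rw [Submodule.mem_comap, hzero]
    exact V.zero_mem
  simpa [Pi.single_apply] using ha _ hmem

/-- A vector orthogonal to the cylinder over `V` along an injection `i` pulls back to a
vector orthogonal to `V`. -/
lemma comp_mem_dualSet_of_mem_dualSet_comap {X Y : Type*} [Fintype X] [Fintype Y] {i : X → Y}
    (hi : Function.Injective i) {V : Submodule F (X → F)} {a : Y → F}
    (ha : a ∈ dualSet (V.comap (LinearMap.funLeft F F i) : Set (Y → F))) :
    a ∘ i ∈ dualSet (V : Set (X → F)) := by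
  intro f hf
  have hcomp : LinearMap.funLeft F F i (Function.extend i f 0) = f := by
    ext x
    exact hi.extend_apply f 0 x
  rw [← ha (Function.extend i f 0) (by simpa [hcomp] using hf)]
  refine Fintype.sum_of_injective i hi _ _ (fun y hy => ?_) (fun x => ?_)
  · rw [eq_zero_of_mem_dualSet_comap ha hy, mul_zero]
  · rw [hi.extend_apply, Function.comp_apply]

lemma dualSet_matched {S P Q : Type*} [Fintype S] [Fintype P] [Fintype Q]
    (V₁ : Submodule F (S ⊕ P → F)) (V₂ : Submodule F (P ⊕ Q → F)) :
    dualSet (matched (V₁ : Set (S ⊕ P → F)) (V₂ : Set (P ⊕ Q → F)))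
      = skewed (dualSet (V₁ : Set (S ⊕ P → F))) (dualSet (V₂ : Set (P ⊕ Q → F))) := by
  ext h
  constructor
  · intro hh
    have hi : Function.Injective (Sum.map id Sum.inl : S ⊕ P → S ⊕ (P ⊕ Q)) :=
      Function.Injective.sumMap Function.injective_id Sum.inl_injective
    obtain ⟨a, ha, b, hb, hab⟩ := exists_add_of_mem_dualSet_inf
      (V₁.comap (LinearMap.funLeft F F (Sum.map id Sum.inl : S ⊕ P → S ⊕ (P ⊕ Q))))
      (V₂.comap (LinearMap.funLeft F F (Sum.inr : P ⊕ Q → S ⊕ (P ⊕ Q))))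
      (g := triple (h ∘ Sum.inl) 0 (h ∘ Sum.inr)) (by
        rintro f ⟨(hf₁ : LinearMap.funLeft F F _ f ∈ (V₁ : Set (S ⊕ P → F))),
          (hf₂ : LinearMap.funLeft F F _ f ∈ (V₂ : Set (P ⊕ Q → F)))⟩
        have horth := hh (Sum.elim (f ∘ Sum.inl) (f ∘ Sum.inr ∘ Sum.inr))
          ⟨f ∘ Sum.inr ∘ Sum.inl, by
            convert hf₁ using 1
            ext (s | p) <;> rfl, by
            convert hf₂ using 1
            ext (p | q) <;> rfl⟩
        simpa [triple, Fintype.sum_sum_type] using horth)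
    have haQ : ∀ q, a (Sum.inr (Sum.inr q)) = 0 := fun q =>
      eq_zero_of_mem_dualSet_comap ha (by rintro ⟨s | p, hx⟩ <;> simp at hx)
    have hbS : ∀ s, b (Sum.inl s) = 0 := fun s =>
      eq_zero_of_mem_dualSet_comap hb (by simp)
    refine ⟨fun p => a (Sum.inr (Sum.inl p)), ?_, ?_⟩
    · convert comp_mem_dualSet_of_mem_dualSet_comap hi ha using 1
      ext (s | p)
      · simpa [triple, hbS] using (congrFun hab (Sum.inl s)).symm
      · rfl
    · convert comp_mem_dualSet_of_mem_dualSet_comap Sum.inr_injective hb using 1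
      ext (p | q)
      · have hp := congrFun hab (Sum.inr (Sum.inl p))
        simpa using neg_eq_of_add_eq_zero_right hp
      · simpa [triple, haQ] using (congrFun hab (Sum.inr (Sum.inr q))).symm
  · rintro ⟨p, hp₁, hp₂⟩ f ⟨r, hr₁, hr₂⟩
    have h₁ := hp₁ _ hr₁
    have h₂ := hp₂ _ hr₂
    simp only [Fintype.sum_sum_type, Sum.elim_inl, Sum.elim_inr, Function.comp_apply,
      Pi.neg_apply, mul_neg, Finset.sum_neg_distrib] at h₁ h₂ ⊢
    linear_combination h₁ + h₂

lemma dualSet_matchedP {S P : Type*} [Fintype S] [Fintype P]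
    (V₁ : Submodule F (S ⊕ P → F)) (V₃ : Submodule F (P → F)) :
    dualSet (matchedP (V₁ : Set (S ⊕ P → F)) (V₃ : Set (P → F)))
      = matchedP (dualSet (V₁ : Set (S ⊕ P → F))) (dualSet (V₃ : Set (P → F))) := by
  ext h
  constructor
  · intro hh
    obtain ⟨a, ha, b, hb, hab⟩ := exists_add_of_mem_dualSet_inf V₁
      (V₃.comap (LinearMap.funLeft F F (Sum.inr : P → S ⊕ P)))
      (g := Sum.elim h 0) (by
        rintro f ⟨hf₁, hf₂⟩
        have horth := hh (f ∘ Sum.inl) ⟨f ∘ Sum.inr, hf₂, by simpa using hf₁⟩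
        simpa [Fintype.sum_sum_type] using horth)
    have hbS : ∀ s, b (Sum.inl s) = 0 := fun s =>
      eq_zero_of_mem_dualSet_comap hb (by simp)
    have hbP : ∀ p, a (Sum.inr p) = -b (Sum.inr p) := fun p =>
      eq_neg_of_add_eq_zero_left (congrFun hab (Sum.inr p))
    refine ⟨a ∘ Sum.inr, fun f hf => ?_, ?_⟩
    · simpa [hbP] using comp_mem_dualSet_of_mem_dualSet_comap Sum.inr_injective hb f hf
    · convert ha using 1
      ext (s | p)
      · simpa [hbS] using (congrFun hab (Sum.inl s)).symm
      · rfl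
  · rintro ⟨p, hp₃, hp₁⟩ f ⟨r, hr₃, hr₁⟩
    have h₁ := hp₁ _ hr₁
    have h₃ := hp₃ _ hr₃
    simp only [Fintype.sum_sum_type, Sum.elim_inl, Sum.elim_inr] at h₁
    linear_combination h₁ - h₃

/-- **Implicit Duality Theorem.** For vector spaces `V₁` on `S ⊎ P` and `V₂` on `P ⊎ Q`
(`S, P, Q` pairwise disjoint finite sets), `(V₁ ↔ V₂)ᵖᵉʳᵖ = V₁ᵖᵉʳᵖ ⇌ V₂ᵖᵉʳᵖ`;
in particular, for any vector space `V₃` on `P`, `(V₁ ↔ V₃)ᵖᵉʳᵖ = V₁ᵖᵉʳᵖ ↔ V₃ᵖᵉʳᵖ`. -/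
theorem implicit_duality {S P Q : Type*} [Fintype S] [Fintype P] [Fintype Q]
    (V₁ : Submodule F (S ⊕ P → F)) (V₂ : Submodule F (P ⊕ Q → F))
    (V₃ : Submodule F (P → F)) :
    dualSet (matched (V₁ : Set (S ⊕ P → F)) (V₂ : Set (P ⊕ Q → F)))
      = skewed (dualSet (V₁ : Set (S ⊕ P → F))) (dualSet (V₂ : Set (P ⊕ Q → F))) ∧
    dualSet (matchedP (V₁ : Set (S ⊕ P → F)) (V₃ : Set (P → F)))
      = matchedP (dualSet (V₁ : Set (S ⊕ P → F))) (dualSet (V₃ : Set (P → F))) :=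
  ⟨dualSet_matched V₁ V₂, dualSet_matchedP V₁ V₃⟩

end ILA
end

section
/- Implicit Inversion Theorem (linear version): Let S, P, Q be pairwise disjoint finite sets and let V_SP, V_SQ be vector spaces on S⊎P and S⊎Q over a field F. (1) There exists a vector space V_PQ on P⊎Q with V_SP ↔ V_PQ = V_SQ only if V_SP∘S ⊇ V_SQ∘S and V_SP×S ⊆ V_SQ×S. (2) If V_SP∘S ⊇ V_SQ∘S and V_SP×S ⊆ V_SQ×S, then V̂_PQ := V_SP ↔ V_SQ satisfies V_SP ↔ V̂_PQ = V_SQ. (3) If vector spaces V_PQ and V'_PQ on P⊎Q both satisfy the equation V_SP ↔ · = V_SQ and both satisfy the additional conditions V_SP∘P ⊇ ·∘P and V_SP×P ⊆ ·×P, then V_PQ = V'_PQ. -/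
namespace ILA

variable {F : Type*} [Field F]

theorem mem_restrL_of_mem {R X Y : Type*} {K : Set (X ⊕ Y → R)} {h : X ⊕ Y → R} (hh : h ∈ K) :
    h ∘ Sum.inl ∈ restrL K :=
  ⟨h ∘ Sum.inr, by rwa [Sum.elim_comp_inl_inr]⟩

theorem sub_mem_contrL {X Y : Type*} {V : Submodule F (X ⊕ Y → F)} {f f' : X → F} {g : Y → F}
    (h : Sum.elim f g ∈ V) (h' : Sum.elim f' g ∈ V) : f - f' ∈ contrL (V : Set (X ⊕ Y → F)) := by
  have := V.sub_mem h h'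
  rwa [← Sum.elim_sub_sub, sub_self] at this

theorem sub_mem_contrR {X Y : Type*} {V : Submodule F (X ⊕ Y → F)} {f : X → F} {g g' : Y → F}
    (h : Sum.elim f g ∈ V) (h' : Sum.elim f g' ∈ V) : g - g' ∈ contrR (V : Set (X ⊕ Y → F)) := by
  have := V.sub_mem h h'
  rwa [← Sum.elim_sub_sub, sub_self] at this

/-- The left component of a vector of `V` may be changed by any difference in `contrL V`. -/
theorem elim_mem_of_sub_mem_contrL {X Y : Type*} {V : Submodule F (X ⊕ Y → F)} {f f' : X → F}
    {g : Y → F} (hsub : f - f' ∈ contrL (V : Set (X ⊕ Y → F))) (h : Sum.elim f' g ∈ V) :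
    Sum.elim f g ∈ V := by
  have := V.add_mem hsub h
  rwa [← Sum.elim_add_add, sub_add_cancel, zero_add] at this

theorem restrL_matched_subset {R S P Q : Type*} (K₁ : Set (S ⊕ P → R)) (K₂ : Set (P ⊕ Q → R)) :
    restrL (matched K₁ K₂) ⊆ restrL K₁ :=
  fun _ ⟨_, p, hp, _⟩ => ⟨p, hp⟩

theorem contrL_subset_contrL_matched {S P Q : Type*} (K₁ : Set (S ⊕ P → F))
    {K₂ : Set (P ⊕ Q → F)} (h₀ : 0 ∈ K₂) : contrL K₁ ⊆ contrL (matched K₁ K₂) :=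
  fun _ hf => ⟨0, hf, by simpa using h₀⟩

theorem matched_matchedL_eq {S P Q : Type*} {V₁ : Submodule F (S ⊕ P → F)}
    {V₃ : Submodule F (S ⊕ Q → F)}
    (hr : restrL (V₃ : Set (S ⊕ Q → F)) ⊆ restrL (V₁ : Set (S ⊕ P → F)))
    (hc : contrL (V₁ : Set (S ⊕ P → F)) ⊆ contrL (V₃ : Set (S ⊕ Q → F))) :
    matched (V₁ : Set (S ⊕ P → F)) (matchedL (V₁ : Set (S ⊕ P → F)) (V₃ : Set (S ⊕ Q → F)))
      = (V₃ : Set (S ⊕ Q → F)) := by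
  ext h
  constructor
  · rintro ⟨p, hp, s, hs, hq⟩
    have := elim_mem_of_sub_mem_contrL (hc (sub_mem_contrL hp hs)) hq
    rwa [Sum.elim_comp_inr, Sum.elim_comp_inl_inr] at this
  · intro hh
    obtain ⟨p, hp⟩ := hr (mem_restrL_of_mem hh)
    exact ⟨p, hp, h ∘ Sum.inl, hp, by rwa [Sum.elim_comp_inr, Sum.elim_comp_inl_inr]⟩

theorem le_of_matched_subset {S P Q : Type*} {V₁ : Submodule F (S ⊕ P → F)}
    {V₂ V₂' : Submodule F (P ⊕ Q → F)}
    (hm : matched (V₁ : Set (S ⊕ P → F)) (V₂ : Set (P ⊕ Q → F)) ⊆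
      matched (V₁ : Set (S ⊕ P → F)) (V₂' : Set (P ⊕ Q → F)))
    (hr : restrL (V₂ : Set (P ⊕ Q → F)) ⊆ restrR (V₁ : Set (S ⊕ P → F)))
    (hc : contrR (V₁ : Set (S ⊕ P → F)) ⊆ contrL (V₂' : Set (P ⊕ Q → F))) :
    V₂ ≤ V₂' := by
  intro h hh
  obtain ⟨s, hs⟩ := hr (mem_restrL_of_mem hh)
  obtain ⟨p, hp, hp'⟩ := hm (show Sum.elim s (h ∘ Sum.inr) ∈ _ from
    ⟨h ∘ Sum.inl, hs, by rwa [Sum.elim_comp_inr, Sum.elim_comp_inl_inr]⟩)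
  have := elim_mem_of_sub_mem_contrL (hc (sub_mem_contrR hs hp)) hp'
  rwa [Sum.elim_comp_inr, Sum.elim_comp_inl_inr] at this

/-- **Implicit Inversion Theorem (linear version).** For vector spaces `V₁` on `S ⊎ P`
and `V₃` on `S ⊎ Q`:
(1) a vector space `V₂` on `P ⊎ Q` with `V₁ ↔ V₂ = V₃` exists only if
`V₁∘S ⊇ V₃∘S` and `V₁×S ⊆ V₃×S`;
(2) if `V₁∘S ⊇ V₃∘S` and `V₁×S ⊆ V₃×S` then `V̂₂ := V₁ ↔ V₃` satisfies `V₁ ↔ V̂₂ = V₃`;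
(3) solutions `V₂` of `V₁ ↔ V₂ = V₃` satisfying `V₁∘P ⊇ V₂∘P` and `V₁×P ⊆ V₂×P`
are unique. -/
theorem implicit_inversion {S P Q : Type*} [Fintype S] [Fintype P] [Fintype Q]
    (V₁ : Submodule F (S ⊕ P → F)) (V₃ : Submodule F (S ⊕ Q → F)) :
    ((∃ V₂ : Submodule F (P ⊕ Q → F),
        matched (V₁ : Set (S ⊕ P → F)) (V₂ : Set (P ⊕ Q → F)) = (V₃ : Set (S ⊕ Q → F))) →
      restrL (V₃ : Set (S ⊕ Q → F)) ⊆ restrL (V₁ : Set (S ⊕ P → F)) ∧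
      contrL (V₁ : Set (S ⊕ P → F)) ⊆ contrL (V₃ : Set (S ⊕ Q → F))) ∧
    ((restrL (V₃ : Set (S ⊕ Q → F)) ⊆ restrL (V₁ : Set (S ⊕ P → F)) ∧
      contrL (V₁ : Set (S ⊕ P → F)) ⊆ contrL (V₃ : Set (S ⊕ Q → F))) →
      matched (V₁ : Set (S ⊕ P → F))
          (matchedL (V₁ : Set (S ⊕ P → F)) (V₃ : Set (S ⊕ Q → F)))
        = (V₃ : Set (S ⊕ Q → F))) ∧
    (∀ V₂ V₂' : Submodule F (P ⊕ Q → F),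
      matched (V₁ : Set (S ⊕ P → F)) (V₂ : Set (P ⊕ Q → F)) = (V₃ : Set (S ⊕ Q → F)) →
      matched (V₁ : Set (S ⊕ P → F)) (V₂' : Set (P ⊕ Q → F)) = (V₃ : Set (S ⊕ Q → F)) →
      restrL (V₂ : Set (P ⊕ Q → F)) ⊆ restrR (V₁ : Set (S ⊕ P → F)) →
      restrL (V₂' : Set (P ⊕ Q → F)) ⊆ restrR (V₁ : Set (S ⊕ P → F)) →
      contrR (V₁ : Set (S ⊕ P → F)) ⊆ contrL (V₂ : Set (P ⊕ Q → F)) →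
      contrR (V₁ : Set (S ⊕ P → F)) ⊆ contrL (V₂' : Set (P ⊕ Q → F)) →
      V₂ = V₂') := by
  refine ⟨?_, fun h => matched_matchedL_eq h.1 h.2, ?_⟩
  · rintro ⟨V₂, h⟩
    rw [← h]
    exact ⟨restrL_matched_subset _ _, contrL_subset_contrL_matched _ V₂.zero_mem⟩
  · intro V₂ V₂' h h' hr hr' hc hc'
    exact le_antisymm (le_of_matched_subset (h.trans h'.symm).subset hr hc')
      (le_of_matched_subset (h'.trans h.symm).subset hr' hc)

end ILA
end

section
/- Affine implicit inversion: Let S, P, Q be pairwise disjoint finite sets, and let A_SP, A_PQ be affine spaces on S⊎P and P⊎Q over a field F, with vector space translates V_SP, V_PQ respectively. Suppose A_SP ↔ A_PQ is nonempty and γ ∈ A_SP ↔ A_PQ. Then: (1) A_SP ↔ A_PQ = γ + (V_SP ↔ V_PQ); (2) A_PQ = A_SP ↔ (A_SP ↔ A_PQ) if and only if V_SP∘P ⊇ V_PQ∘P and V_SP×P ⊆ V_PQ×P. -/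
namespace ILA

variable {F : Type*} [Field F]

theorem mem_coset {X : Type*} {a v : X → F} {K : Set (X → F)} : v ∈ coset a K ↔ v - a ∈ K :=
  ⟨fun ⟨u, hu, h⟩ => by simpa [h] using hu, fun h => ⟨v - a, h, by simp⟩⟩

theorem coset_injective {X : Type*} (a : X → F) : Function.Injective (coset a) := by
  intro K L h
  ext v
  simpa [mem_coset] using Set.ext_iff.1 h (a + v)

theorem coset_eq_coset_of_mem {X : Type*} {a b : X → F} {V : Submodule F (X → F)}
    (h : b ∈ coset a (V : Set (X → F))) :
    coset a (V : Set (X → F)) = coset b (V : Set (X → F)) := by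
  rw [mem_coset, SetLike.mem_coe] at h
  ext v
  rw [mem_coset, mem_coset, SetLike.mem_coe, SetLike.mem_coe,
    ← V.sub_mem_iff_left h, sub_sub_sub_cancel_right]

theorem elim_mem_coset_elim {X Y : Type*} {f f₀ : X → F} {g g₀ : Y → F}
    {K : Set (X ⊕ Y → F)} :
    Sum.elim f g ∈ coset (Sum.elim f₀ g₀) K ↔ Sum.elim (f - f₀) (g - g₀) ∈ K := by
  rw [mem_coset, Sum.elim_sub_sub]

theorem matched_coset {S P Q : Type*} (s : S → F) (p : P → F) (q : Q → F)
    (K₁ : Set (S ⊕ P → F)) (K₂ : Set (P ⊕ Q → F)) :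
    matched (coset (Sum.elim s p) K₁) (coset (Sum.elim p q) K₂)
      = coset (Sum.elim s q) (matched K₁ K₂) := by
  ext h
  rw [mem_coset]
  simp only [matched, Set.mem_ofPred_eq, elim_mem_coset_elim]
  exact (Equiv.subRight p).exists_congr_left.trans (by simp; rfl)

theorem matchedL_coset {S P Q : Type*} (s : S → F) (p : P → F) (q : Q → F)
    (K₁ : Set (S ⊕ P → F)) (K₂ : Set (S ⊕ Q → F)) :
    matchedL (coset (Sum.elim s p) K₁) (coset (Sum.elim s q) K₂)
      = coset (Sum.elim p q) (matchedL K₁ K₂) := by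
  ext h
  rw [mem_coset]
  simp only [matchedL, Set.mem_ofPred_eq, elim_mem_coset_elim]
  exact (Equiv.subRight s).exists_congr_left.trans (by simp; rfl)

/-- **Implicit inversion** for vector spaces. -/
theorem eq_matchedL_matched_iff {S P Q : Type*}
    (V₁ : Submodule F (S ⊕ P → F)) (V₂ : Submodule F (P ⊕ Q → F)) :
    (V₂ : Set (P ⊕ Q → F)) = matchedL (V₁ : Set (S ⊕ P → F))
        (matched (V₁ : Set (S ⊕ P → F)) (V₂ : Set (P ⊕ Q → F))) ↔
      restrL (V₂ : Set (P ⊕ Q → F)) ⊆ restrR (V₁ : Set (S ⊕ P → F)) ∧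
        contrR (V₁ : Set (S ⊕ P → F)) ⊆ contrL (V₂ : Set (P ⊕ Q → F)) := by
  constructor
  · intro h
    refine ⟨?_, fun p hp => ?_⟩
    · rintro p ⟨q, hpq⟩
      rw [h] at hpq
      obtain ⟨s, hs, -⟩ := hpq
      exact ⟨s, hs⟩
    · change Sum.elim p (0 : Q → F) ∈ (V₂ : Set (P ⊕ Q → F))
      rw [h]
      refine ⟨0, hp, 0, ?_, ?_⟩
      · simp
      · simp
  · rintro ⟨hrestr, hcontr⟩
    ext h
    constructor
    · intro hh
      rw [← Sum.elim_comp_inl_inr h] at hh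
      obtain ⟨s, hs⟩ := hrestr ⟨_, hh⟩
      exact ⟨s, hs, h ∘ Sum.inl, hs, hh⟩
    · rintro ⟨s, hs, p, hsp, hpq⟩
      have hdiff := V₁.sub_mem hs hsp
      rw [← Sum.elim_sub_sub, Sum.elim_comp_inl, sub_self] at hdiff
      have hsum := V₂.add_mem (hcontr hdiff) hpq
      rwa [← Sum.elim_add_add, sub_add_cancel, zero_add, Sum.elim_comp_inr,
        Sum.elim_comp_inl_inr] at hsum

/-- **Affine implicit inversion.** For affine spaces `α + V₁` on `S ⊎ P` and `β + V₂` on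
`P ⊎ Q` whose matched composition is nonempty, containing `γ`:
(1) `(α + V₁) ↔ (β + V₂) = γ + (V₁ ↔ V₂)`;
(2) `β + V₂ = (α + V₁) ↔ ((α + V₁) ↔ (β + V₂))` iff `V₁∘P ⊇ V₂∘P` and `V₁×P ⊆ V₂×P`. -/
theorem affine_implicit_inversion {S P Q : Type*} [Fintype S] [Fintype P] [Fintype Q]
    (V₁ : Submodule F (S ⊕ P → F)) (V₂ : Submodule F (P ⊕ Q → F))
    (α : S ⊕ P → F) (β : P ⊕ Q → F) (γ : S ⊕ Q → F)
    (hγ : γ ∈ matched (coset α (V₁ : Set (S ⊕ P → F))) (coset β (V₂ : Set (P ⊕ Q → F)))) :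
    matched (coset α (V₁ : Set (S ⊕ P → F))) (coset β (V₂ : Set (P ⊕ Q → F)))
        = coset γ (matched (V₁ : Set (S ⊕ P → F)) (V₂ : Set (P ⊕ Q → F))) ∧
    (coset β (V₂ : Set (P ⊕ Q → F))
        = matchedL (coset α (V₁ : Set (S ⊕ P → F)))
            (matched (coset α (V₁ : Set (S ⊕ P → F))) (coset β (V₂ : Set (P ⊕ Q → F)))) ↔
      (restrL (V₂ : Set (P ⊕ Q → F)) ⊆ restrR (V₁ : Set (S ⊕ P → F)) ∧
       contrR (V₁ : Set (S ⊕ P → F)) ⊆ contrL (V₂ : Set (P ⊕ Q → F)))) := by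
  obtain ⟨p, h₁, h₂⟩ := hγ
  have hmatched := matched_coset (γ ∘ Sum.inl) p (γ ∘ Sum.inr)
    (V₁ : Set (S ⊕ P → F)) (V₂ : Set (P ⊕ Q → F))
  rw [coset_eq_coset_of_mem h₁, coset_eq_coset_of_mem h₂, hmatched, matchedL_coset,
    (coset_injective _).eq_iff, Sum.elim_comp_inl_inr]
  exact ⟨rfl, eq_matchedL_matched_iff V₁ V₂⟩

end ILA
end

section
/- Rank of a matched composition: Let S, P, Q be pairwise disjoint finite sets and let V_SP, V_PQ be vector spaces on S⊎P and P⊎Q over a field F. Then r(V_SP ↔ V_PQ) = r(V_SP×S) + r(V_PQ×Q) + r(V_SP∘P ∩ V_PQ∘P) − r(V_SP×P ∩ V_PQ×P), where the intersections are ordinary intersections of subspaces of F^P. -/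
namespace ILA

variable {F : Type*} [Field F]

theorem rk_coe {X : Type*} (U : Submodule F (X → F)) :
    rk (U : Set (X → F)) = Module.finrank F U := by
  rw [rk, Submodule.span_eq]

/-- Rank–nullity for a submodule `W` along an exact sequence `0 → L → M → N`. -/
theorem finrank_map_add_finrank_comap {L M N : Type*} [AddCommGroup L] [Module F L]
    [AddCommGroup M] [Module F M] [FiniteDimensional F M] [AddCommGroup N] [Module F N]
    (j : L →ₗ[F] M) (g : M →ₗ[F] N) (hj : Function.Injective j)
    (hjg : LinearMap.ker g = LinearMap.range j) (W : Submodule F M) :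
    Module.finrank F (W.map g) + Module.finrank F (W.comap j) = Module.finrank F W := by
  rw [← (g.domRestrict W).finrank_range_add_finrank_ker, LinearMap.range_domRestrict,
    ← Submodule.finrank_map_subtype_eq W (LinearMap.ker (g.domRestrict W)),
    LinearMap.ker_domRestrict, Submodule.map_comap_subtype, hjg, inf_comm,
    ← Submodule.map_comap_eq,
    (Submodule.equivMapOfInjective j hj (W.comap j)).finrank_eq]

/-- The linear equivalence pasting functions on `X` and on `Y` to a function on `X ⊎ Y`. -/
def elimEquiv (F : Type*) [Field F] (X Y : Type*) : ((X → F) × (Y → F)) ≃ₗ[F] (X ⊕ Y → F) :=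
  (LinearEquiv.sumArrowLequivProdArrow X Y F F).symm

/-- The compatible pairs of vectors of `V₁` and `V₂`, as triples on `S`, `P`, `Q`. -/
def compatible {S P Q : Type*} (V₁ : Submodule F (S ⊕ P → F)) (V₂ : Submodule F (P ⊕ Q → F)) :
    Submodule F (((S → F) × (Q → F)) × (P → F)) :=
  V₁.comap ((elimEquiv F S P).toLinearMap ∘ₗ (LinearMap.fst F _ _).prodMap LinearMap.id) ⊓
    V₂.comap ((elimEquiv F P Q).toLinearMap ∘ₗ
      (LinearMap.snd F _ _).prod (LinearMap.snd F _ _ ∘ₗ LinearMap.fst F _ _))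

/-- **Rank of a matched composition.**
`r(V₁ ↔ V₂) = r(V₁×S) + r(V₂×Q) + r(V₁∘P ∩ V₂∘P) − r(V₁×P ∩ V₂×P)`. -/
theorem rank_matched {S P Q : Type*} [Fintype S] [Fintype P] [Fintype Q]
    (V₁ : Submodule F (S ⊕ P → F)) (V₂ : Submodule F (P ⊕ Q → F)) :
    (rk (matched (V₁ : Set (S ⊕ P → F)) (V₂ : Set (P ⊕ Q → F))) : ℤ)
      = (rk (contrL (V₁ : Set (S ⊕ P → F))) : ℤ)
        + (rk (contrR (V₂ : Set (P ⊕ Q → F))) : ℤ)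
        + (rk (restrR (V₁ : Set (S ⊕ P → F)) ∩ restrL (V₂ : Set (P ⊕ Q → F))) : ℤ)
        - (rk (contrR (V₁ : Set (S ⊕ P → F)) ∩ contrL (V₂ : Set (P ⊕ Q → F))) : ℤ) := by
  let W := compatible V₁ V₂
  let A := V₁.comap ((elimEquiv F S P).toLinearMap ∘ₗ LinearMap.inl F _ _)
  let B := V₂.comap ((elimEquiv F P Q).toLinearMap ∘ₗ LinearMap.inr F _ _)
  have hA : contrL (V₁ : Set (S ⊕ P → F)) = A := rfl
  have hB : contrR (V₂ : Set (P ⊕ Q → F)) = B := rfl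
  have hmatched : matched (V₁ : Set (S ⊕ P → F)) (V₂ : Set (P ⊕ Q → F)) =
      (W.map (LinearMap.fst F _ _)).map (elimEquiv F S Q).toLinearMap := by
    ext h
    constructor
    · rintro ⟨p, h₁, h₂⟩
      exact ⟨(h ∘ Sum.inl, h ∘ Sum.inr), ⟨((h ∘ Sum.inl, h ∘ Sum.inr), p), ⟨h₁, h₂⟩, rfl⟩,
        Sum.elim_comp_inl_inr h⟩
    · rintro ⟨_, ⟨⟨_, p⟩, hv, rfl⟩, rfl⟩
      exact ⟨p, hv⟩
  have hrestr : restrR (V₁ : Set (S ⊕ P → F)) ∩ restrL (V₂ : Set (P ⊕ Q → F)) =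
      W.map (LinearMap.snd F _ _) := by
    ext p
    constructor
    · rintro ⟨⟨s, h₁⟩, ⟨q, h₂⟩⟩
      exact ⟨((s, q), p), ⟨h₁, h₂⟩, rfl⟩
    · rintro ⟨⟨⟨s, q⟩, p⟩, ⟨h₁, h₂⟩, rfl⟩
      exact ⟨⟨s, h₁⟩, ⟨q, h₂⟩⟩
  have hcontr : contrR (V₁ : Set (S ⊕ P → F)) ∩ contrL (V₂ : Set (P ⊕ Q → F)) =
      W.comap (LinearMap.inr F _ _) := rfl
  have hAB : Module.finrank F (W.comap (LinearMap.inl F _ _)) =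
      Module.finrank F A + Module.finrank F B := by
    have h := finrank_map_add_finrank_comap (LinearMap.inr F _ _) (LinearMap.fst F _ _)
      LinearMap.inr_injective (LinearMap.range_inr F _ _).symm (A.prod B)
    rw [Submodule.prod_map_fst, Submodule.prod_comap_inr] at h
    exact h.symm
  have h₁ := finrank_map_add_finrank_comap (LinearMap.inr F _ _) (LinearMap.fst F _ _)
    LinearMap.inr_injective (LinearMap.range_inr F _ _).symm W
  have h₂ := finrank_map_add_finrank_comap (LinearMap.inl F _ _) (LinearMap.snd F _ _)
    LinearMap.inl_injective (LinearMap.range_inl F _ _).symm W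
  rw [hmatched, hA, hB, hrestr, hcontr, rk_coe, rk_coe, rk_coe, rk_coe, rk_coe,
    LinearEquiv.finrank_map_eq]
  omega

end ILA
end

section
/- Let S and P be disjoint finite sets and V_SP a vector space on S⊎P over a field F, with orthogonality taken relative to the standard dot product. Then V_SP⊥ ∘ P = (V_SP × P)⊥ (orthogonal complement within F^P) and V_SP⊥ × S = (V_SP ∘ S)⊥ (orthogonal complement within F^S). -/
namespace ILA

variable {F : Type*} [Field F]

/-- A functional that vanishes on the contraction of `V` to its right component agrees on `V` with
one that depends only on the left component. -/
theorem exists_left_functional {S P : Type*} (V : Submodule F (S ⊕ P → F))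
    (φ : Module.Dual F (P → F)) (hφ : ∀ p ∈ contrR (V : Set (S ⊕ P → F)), φ p = 0) :
    ∃ ψ : Module.Dual F (S → F), ∀ v ∈ V, ψ (v ∘ Sum.inl) = φ (v ∘ Sum.inr) := by
  let π : V →ₗ[F] (S → F) := LinearMap.funLeft F F Sum.inl ∘ₗ V.subtype
  let θ : Module.Dual F V := φ ∘ₗ LinearMap.funLeft F F Sum.inr ∘ₗ V.subtype
  have hθ : θ ∈ LinearMap.range π.dualMap := by
    rw [LinearMap.range_dualMap_eq_dualAnnihilator_ker, Submodule.mem_dualAnnihilator]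
    rintro ⟨v, hv⟩ hker
    have hleft : v ∘ Sum.inl = 0 := hker
    refine hφ (v ∘ Sum.inr) ?_
    change Sum.elim (0 : S → F) (v ∘ Sum.inr) ∈ V
    rwa [← hleft, Sum.elim_comp_inl_inr]
  obtain ⟨ψ, hψ⟩ := hθ
  exact ⟨ψ, fun v hv => LinearMap.congr_fun hψ ⟨v, hv⟩⟩

/-- `V⊥ ∘ P = (V × P)⊥` and `V⊥ × S = (V ∘ S)⊥` for a vector space `V` on `S ⊎ P`. -/
theorem dual_minor {S P : Type*} [Fintype S] [Fintype P]
    (V : Submodule F (S ⊕ P → F)) :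
    restrR (dualSet (V : Set (S ⊕ P → F))) = dualSet (contrR (V : Set (S ⊕ P → F))) ∧
    contrL (dualSet (V : Set (S ⊕ P → F))) = dualSet (restrL (V : Set (S ⊕ P → F))) := by
  classical
  refine ⟨Set.Subset.antisymm ?_ ?_, Set.Subset.antisymm ?_ ?_⟩
  · rintro g ⟨f, hf⟩ p hp
    simpa using hf _ hp
  · intro g hg
    obtain ⟨ψ, hψ⟩ := exists_left_functional V (∑ x, g x • LinearMap.proj x) fun p hp => by
      simpa [mul_comm] using hg p hp
    refine ⟨fun s => -ψ (fun j => if s = j then 1 else 0), fun v hv => ?_⟩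
    have h := hψ v hv
    rw [LinearMap.pi_apply_eq_sum_univ ψ] at h
    simp only [Function.comp_apply, smul_eq_mul, LinearMap.coe_sum, LinearMap.smul_apply,
      Finset.sum_apply, LinearMap.proj_apply] at h
    simp [h, mul_comm]
  · rintro f hf s ⟨p, hsp⟩
    simpa using hf _ hsp
  · intro f hf v hv
    have h := hf (v ∘ Sum.inl) ⟨v ∘ Sum.inr, by rwa [Sum.elim_comp_inl_inr]⟩
    simpa using h

end ILA
end

section
/- Matched composition of Dirac structures is Dirac: Let S and P be disjoint finite sets over a field F. Let V₁ be a vector space on (S⊎P)⊎(S⊎P) and V₂ a vector space on S⊎S, and suppose both are Dirac. Define V₁ ↔ V₂ := {(f_P, g_P) ∈ F^{P⊎P} : there exist f_S, g_S with ((f_S,f_P),(g_S,g_P)) ∈ V₁ and (f_S,g_S) ∈ V₂}. Then V₁ ↔ V₂ is a Dirac vector space on P⊎P. -/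
namespace ILA

variable {F : Type*} [Field F]

/-- The symmetric pairing `(f, g), (f', g') ↦ ⟨f, g'⟩ + ⟨g, f'⟩` on `F^(Y ⊎ Y)`. -/
def pairing (F : Type*) [Field F] (Y : Type*) [Fintype Y] :
    (Y ⊕ Y → F) →ₗ[F] (Y ⊕ Y → F) →ₗ[F] F :=
  LinearMap.mk₂ F (fun u v => u ⬝ᵥ (v ∘ Sum.swap))
    (fun _ _ _ => add_dotProduct _ _ _)
    (fun _ _ _ => smul_dotProduct _ _ _)
    (fun _ _ _ => dotProduct_add _ _ _)
    (fun _ _ _ => dotProduct_smul _ _ _)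

theorem pairing_apply {Y : Type*} [Fintype Y] (u v : Y ⊕ Y → F) :
    pairing F Y u v = ∑ x, u x * v x.swap := rfl

theorem pairing_comm {Y : Type*} [Fintype Y] (u v : Y ⊕ Y → F) :
    pairing F Y u v = pairing F Y v u := by
  simp [pairing_apply, Fintype.sum_sum_type, mul_comm, add_comm]

theorem isDirac_iff_forall_pairing {Y : Type*} [Fintype Y] (K : Set (Y ⊕ Y → F)) :
    IsDirac K ↔ ∀ v, v ∈ K ↔ ∀ u ∈ K, pairing F Y u v = 0 := by
  have hswap (v : Y ⊕ Y → F) : Sum.elim (v ∘ Sum.inr) (v ∘ Sum.inl) = v ∘ Sum.swap := by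
    ext (x | x) <;> rfl
  have hinv (v : Y ⊕ Y → F) : (v ∘ Sum.swap) ∘ Sum.swap = v := by
    ext x; simp
  have hmem (v : Y ⊕ Y → F) : v ∘ Sum.swap ∈ swapSet K ↔ v ∈ K := by
    simp only [swapSet, hswap, Set.mem_image]
    constructor
    · rintro ⟨u, hu, h⟩
      rwa [← hinv v, ← h, hinv]
    · exact fun h => ⟨v, h, rfl⟩
  constructor
  · intro h v
    rw [← hmem, h]
    rfl
  · intro h
    ext v
    rw [← hinv v, hmem, h]
    rfl

/-- The coordinates of a vector on `X ⊎ X` indexed by a set mapping to `X`. -/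
def coords (F : Type*) [Field F] {X Y : Type*} (i : Y → X) :
    (X ⊕ X → F) →ₗ[F] (Y ⊕ Y → F) :=
  LinearMap.funLeft F F (Sum.map i i)

theorem coords_apply {X Y : Type*} (i : Y → X) (u : X ⊕ X → F) :
    coords F i u = u ∘ Sum.map i i := rfl

theorem pairing_eq_add_coords {S P : Type*} [Fintype S] [Fintype P]
    (u v : (S ⊕ P) ⊕ (S ⊕ P) → F) :
    pairing F (S ⊕ P) u v =
      pairing F S (coords F Sum.inl u) (coords F Sum.inl v) +
        pairing F P (coords F Sum.inr u) (coords F Sum.inr v) := by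
  simp only [pairing_apply, coords_apply, Fintype.sum_sum_type, Function.comp_apply,
    Sum.map_inl, Sum.map_inr, Sum.swap_inl, Sum.swap_inr]
  ring

/-- Assemble a vector on `(S ⊎ P) ⊎ (S ⊎ P)` from its components on `S ⊎ S` and `P ⊎ P`. -/
def assemble {S P : Type*} (s : S ⊕ S → F) (w : P ⊕ P → F) : (S ⊕ P) ⊕ (S ⊕ P) → F :=
  Sum.elim (Sum.elim (s ∘ Sum.inl) (w ∘ Sum.inl)) (Sum.elim (s ∘ Sum.inr) (w ∘ Sum.inr))

theorem coords_inl_assemble {S P : Type*} (s : S ⊕ S → F) (w : P ⊕ P → F) :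
    coords F Sum.inl (assemble s w) = s := by
  ext (x | x) <;> rfl

theorem coords_inr_assemble {S P : Type*} (s : S ⊕ S → F) (w : P ⊕ P → F) :
    coords F Sum.inr (assemble s w) = w := by
  ext (x | x) <;> rfl

theorem assemble_coords {S P : Type*} (v : (S ⊕ P) ⊕ (S ⊕ P) → F) :
    assemble (coords F Sum.inl v) (coords F Sum.inr v) = v := by
  ext ((x | x) | (x | x)) <;> rfl

/-- The matched composition of `V₁` and `V₂` over `S ⊎ S`, as a subspace. -/
def matchedSubmodule {S P : Type*} (V₁ : Submodule F ((S ⊕ P) ⊕ (S ⊕ P) → F))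
    (V₂ : Submodule F (S ⊕ S → F)) : Submodule F (P ⊕ P → F) :=
  (V₁ ⊓ V₂.comap (coords F Sum.inl)).map (coords F Sum.inr)

theorem mem_matchedSubmodule {S P : Type*} {V₁ : Submodule F ((S ⊕ P) ⊕ (S ⊕ P) → F)}
    {V₂ : Submodule F (S ⊕ S → F)} {w : P ⊕ P → F} :
    w ∈ matchedSubmodule V₁ V₂ ↔ ∃ s ∈ V₂, assemble s w ∈ V₁ := by
  simp only [matchedSubmodule, Submodule.mem_map, Submodule.mem_inf, Submodule.mem_comap]
  constructor
  · rintro ⟨v, ⟨hv, hs⟩, rfl⟩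
    exact ⟨_, hs, by rwa [assemble_coords]⟩
  · rintro ⟨s, hs, hv⟩
    exact ⟨_, ⟨hv, by rwa [coords_inl_assemble]⟩, coords_inr_assemble s w⟩

/-- A functional on a finite-dimensional space that vanishes wherever all functionals in the
range of a linear family do belongs to that family. -/
theorem exists_eq_of_forall_apply_eq_zero {E U : Type*} [AddCommGroup E] [Module F E]
    [FiniteDimensional F E] [AddCommGroup U] [Module F U] (L : U →ₗ[F] Module.Dual F E)
    (φ : Module.Dual F E) (h : ∀ v, (∀ s, L s v = 0) → φ v = 0) : ∃ s, L s = φ := by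
  have hφ : φ ∈ (LinearMap.range L).dualCoannihilator.dualAnnihilator := by
    rw [Submodule.mem_dualAnnihilator]
    intro v hv
    rw [Submodule.mem_dualCoannihilator] at hv
    exact h v fun s => hv _ ⟨s, rfl⟩
  rwa [Subspace.dualCoannihilator_dualAnnihilator_eq] at hφ

theorem isDirac_matchedSubmodule {S P : Type*} [Fintype S] [Fintype P]
    {V₁ : Submodule F ((S ⊕ P) ⊕ (S ⊕ P) → F)} {V₂ : Submodule F (S ⊕ S → F)}
    (h₁ : IsDirac (V₁ : Set ((S ⊕ P) ⊕ (S ⊕ P) → F))) (h₂ : IsDirac (V₂ : Set (S ⊕ S → F))) :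
    IsDirac (matchedSubmodule V₁ V₂ : Set (P ⊕ P → F)) := by
  rw [isDirac_iff_forall_pairing] at h₁ h₂ ⊢
  simp only [SetLike.mem_coe] at h₁ h₂ ⊢
  intro w
  constructor
  · intro hw u hu
    obtain ⟨s, hs, hsw⟩ := mem_matchedSubmodule.1 hw
    obtain ⟨t, ht, htu⟩ := mem_matchedSubmodule.1 hu
    have h := (h₁ _).1 hsw _ htu
    rwa [pairing_eq_add_coords, coords_inl_assemble, coords_inl_assemble, coords_inr_assemble,
      coords_inr_assemble, (h₂ _).1 hs t ht, zero_add] at h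
  · intro hw
    obtain ⟨s, hs⟩ := exists_eq_of_forall_apply_eq_zero
      ((pairing F S).compl₁₂ V₂.subtype (coords F Sum.inl ∘ₗ V₁.subtype))
      (-(pairing F P w ∘ₗ coords F Sum.inr ∘ₗ V₁.subtype)) (by
        rintro ⟨v, hv⟩ hvS
        have hvV₂ : coords F Sum.inl v ∈ V₂ := (h₂ _).2 fun t ht => hvS ⟨t, ht⟩
        have := hw (coords F Sum.inr v)
          (mem_matchedSubmodule.2 ⟨_, hvV₂, by rwa [assemble_coords]⟩)
        rw [pairing_comm] at this
        simpa using this)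
    refine mem_matchedSubmodule.2 ⟨s, s.2, (h₁ _).2 fun v hv => ?_⟩
    rw [pairing_comm, pairing_eq_add_coords, coords_inl_assemble, coords_inr_assemble]
    have := LinearMap.congr_fun hs ⟨v, hv⟩
    exact eq_neg_iff_add_eq_zero.1 this

/-- **Matched composition of Dirac structures is Dirac.** If `V₁` on `(S⊎P) ⊎ (S⊎P)` and
`V₂` on `S ⊎ S` are Dirac vector spaces, then `V₁ ↔ V₂` is a Dirac vector space on `P ⊎ P`. -/
theorem matched_dirac {S P : Type*} [Fintype S] [Fintype P]
    (V₁ : Submodule F ((S ⊕ P) ⊕ (S ⊕ P) → F)) (V₂ : Submodule F (S ⊕ S → F))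
    (h₁ : IsDirac (V₁ : Set ((S ⊕ P) ⊕ (S ⊕ P) → F)))
    (h₂ : IsDirac (V₂ : Set (S ⊕ S → F))) :
    ∃ W : Submodule F (P ⊕ P → F),
      (W : Set (P ⊕ P → F)) =
        {w : P ⊕ P → F | ∃ fS gS : S → F,
          Sum.elim (Sum.elim fS (w ∘ Sum.inl)) (Sum.elim gS (w ∘ Sum.inr)) ∈ V₁ ∧
          Sum.elim fS gS ∈ V₂} ∧
      IsDirac (W : Set (P ⊕ P → F)) := by
  refine ⟨matchedSubmodule V₁ V₂, ?_, isDirac_matchedSubmodule h₁ h₂⟩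
  ext w
  rw [SetLike.mem_coe, mem_matchedSubmodule]
  constructor
  · rintro ⟨s, hs, hw⟩
    exact ⟨s ∘ Sum.inl, s ∘ Sum.inr, hw, by rwa [Sum.elim_comp_inl_inr]⟩
  · rintro ⟨f, g, hw, hs⟩
    exact ⟨Sum.elim f g, hs, hw⟩

end ILA
end

section
/- Let A, B, C be pairwise disjoint finite sets and let V_AB, V_BC be vector spaces on A⊎B and B⊎C over a field F. Then the following are equivalent: (i) V_AB∘B + V_BC∘B = F_B (the full sum property); (ii) for every α ∈ F^{A⊎B} and β ∈ F^{B⊎C}, the matched composition (α + V_AB) ↔ (β + V_BC) is nonempty. Moreover, when the full sum property holds, for every α and β the set (α + V_AB) ↔ (β + V_BC) is a coset of V_AB ↔ V_BC. -/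
namespace ILA

variable {F : Type*} [Field F]

theorem mem_coset_submodule {X : Type*} {V : Submodule F (X → F)} {a v : X → F} :
    v ∈ coset a (V : Set (X → F)) ↔ v - a ∈ V := by
  constructor
  · rintro ⟨u, hu, rfl⟩
    simpa using hu
  · intro h
    exact ⟨v - a, h, by simp⟩

theorem coset_eq_of_mem {X : Type*} {V : Submodule F (X → F)} {a b : X → F}
    (h : b ∈ coset a (V : Set (X → F))) :
    coset a (V : Set (X → F)) = coset b (V : Set (X → F)) := by
  ext v
  rw [mem_coset_submodule] at h
  rw [mem_coset_submodule, mem_coset_submodule, ← V.sub_mem_iff_left h,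
    sub_sub_sub_cancel_right]

/-- The translates `α + V₁` and `β + V₂` admit a matched pair when the full sum property holds. -/
theorem FullSumSets.matched_coset_nonempty {S P Q : Type*} {V₁ : Submodule F (S ⊕ P → F)}
    {V₂ : Submodule F (P ⊕ Q → F)}
    (hfull : FullSumSets (restrR (V₁ : Set (S ⊕ P → F))) (restrL (V₂ : Set (P ⊕ Q → F))))
    (α : S ⊕ P → F) (β : P ⊕ Q → F) :
    (matched (coset α (V₁ : Set (S ⊕ P → F))) (coset β (V₂ : Set (P ⊕ Q → F)))).Nonempty := by
  obtain ⟨u, ⟨f, hf⟩, v, ⟨g, hg⟩, huv⟩ := hfull (β ∘ Sum.inl - α ∘ Sum.inr)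
  refine ⟨Sum.elim (α ∘ Sum.inl + f) (β ∘ Sum.inr - g), α ∘ Sum.inr + u,
    ⟨_, hf, ?_⟩, ⟨_, V₂.neg_mem hg, ?_⟩⟩
  · ext (x | x) <;> simp
  · ext (x | x)
    · have := congrFun huv x
      simp only [Pi.sub_apply, Pi.add_apply, Function.comp_apply] at this
      simp only [Sum.elim_inl, Pi.add_apply, Pi.neg_apply, Function.comp_apply]
      linear_combination -this
    · simp [sub_eq_add_neg]

theorem fullSumSets_of_matched_coset_nonempty {S P Q : Type*} {V₁ : Submodule F (S ⊕ P → F)}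
    {V₂ : Submodule F (P ⊕ Q → F)}
    (hne : ∀ β : P ⊕ Q → F,
      (matched (coset 0 (V₁ : Set (S ⊕ P → F))) (coset β (V₂ : Set (P ⊕ Q → F)))).Nonempty) :
    FullSumSets (restrR (V₁ : Set (S ⊕ P → F))) (restrL (V₂ : Set (P ⊕ Q → F))) := by
  intro h
  obtain ⟨w, p, h₁, h₂⟩ := hne (Sum.elim h 0)
  rw [mem_coset_submodule] at h₁ h₂
  refine ⟨p, ⟨w ∘ Sum.inl, by simpa using h₁⟩, h - p, ⟨-(w ∘ Sum.inr), ?_⟩, by simp⟩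
  rw [SetLike.mem_coe]
  convert V₂.neg_mem h₂ using 1
  ext (x | x) <;> simp

theorem sub_mem_matched {S P Q : Type*} {V₁ : Submodule F (S ⊕ P → F)}
    {V₂ : Submodule F (P ⊕ Q → F)} {α : S ⊕ P → F} {β : P ⊕ Q → F} {v w : S ⊕ Q → F}
    (hv : v ∈ matched (coset α (V₁ : Set (S ⊕ P → F))) (coset β (V₂ : Set (P ⊕ Q → F))))
    (hw : w ∈ matched (coset α (V₁ : Set (S ⊕ P → F))) (coset β (V₂ : Set (P ⊕ Q → F)))) :
    v - w ∈ matched (V₁ : Set (S ⊕ P → F)) (V₂ : Set (P ⊕ Q → F)) := by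
  obtain ⟨p, hp₁, hp₂⟩ := hv
  obtain ⟨q, hq₁, hq₂⟩ := hw
  rw [coset_eq_of_mem hq₁, mem_coset_submodule] at hp₁
  rw [coset_eq_of_mem hq₂, mem_coset_submodule] at hp₂
  refine ⟨p - q, ?_, ?_⟩
  · rw [SetLike.mem_coe]
    convert hp₁ using 1
    ext (x | x) <;> simp
  · rw [SetLike.mem_coe]
    convert hp₂ using 1
    ext (x | x) <;> simp

theorem add_mem_matched_coset {S P Q : Type*} {V₁ : Submodule F (S ⊕ P → F)}
    {V₂ : Submodule F (P ⊕ Q → F)} {α : S ⊕ P → F} {β : P ⊕ Q → F} {w u : S ⊕ Q → F}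
    (hw : w ∈ matched (coset α (V₁ : Set (S ⊕ P → F))) (coset β (V₂ : Set (P ⊕ Q → F))))
    (hu : u ∈ matched (V₁ : Set (S ⊕ P → F)) (V₂ : Set (P ⊕ Q → F))) :
    w + u ∈ matched (coset α (V₁ : Set (S ⊕ P → F))) (coset β (V₂ : Set (P ⊕ Q → F))) := by
  obtain ⟨q, hq₁, hq₂⟩ := hw
  obtain ⟨p, hp₁, hp₂⟩ := hu
  refine ⟨q + p, ?_, ?_⟩
  · rw [coset_eq_of_mem hq₁]
    exact ⟨_, hp₁, by ext (x | x) <;> simp⟩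
  · rw [coset_eq_of_mem hq₂]
    exact ⟨_, hp₂, by ext (x | x) <;> simp⟩

/-- A nonempty matched composition of translates is a coset of the matched composition. -/
theorem matched_coset_eq_coset {S P Q : Type*} {V₁ : Submodule F (S ⊕ P → F)}
    {V₂ : Submodule F (P ⊕ Q → F)} {α : S ⊕ P → F} {β : P ⊕ Q → F} {γ : S ⊕ Q → F}
    (hγ : γ ∈ matched (coset α (V₁ : Set (S ⊕ P → F))) (coset β (V₂ : Set (P ⊕ Q → F)))) :
    matched (coset α (V₁ : Set (S ⊕ P → F))) (coset β (V₂ : Set (P ⊕ Q → F))) =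
      coset γ (matched (V₁ : Set (S ⊕ P → F)) (V₂ : Set (P ⊕ Q → F))) := by
  ext v
  constructor
  · intro hv
    exact ⟨v - γ, sub_mem_matched hv hγ, by simp⟩
  · rintro ⟨u, hu, rfl⟩
    exact add_mem_matched_coset hγ hu

/-- The full sum property of `{V₁, V₂}` is equivalent to every matched composition of
translates `(α + V₁) ↔ (β + V₂)` being nonempty; and when it holds, every such matched
composition is a coset of `V₁ ↔ V₂`. -/
theorem full_sum_iff_translates_nonempty {A B C : Type*} [Fintype A] [Fintype B] [Fintype C]
    (V₁ : Submodule F (A ⊕ B → F)) (V₂ : Submodule F (B ⊕ C → F)) :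
    (FullSumSets (restrR (V₁ : Set (A ⊕ B → F))) (restrL (V₂ : Set (B ⊕ C → F))) ↔
      ∀ (α : A ⊕ B → F) (β : B ⊕ C → F),
        (matched (coset α (V₁ : Set (A ⊕ B → F)))
          (coset β (V₂ : Set (B ⊕ C → F)))).Nonempty) ∧
    (FullSumSets (restrR (V₁ : Set (A ⊕ B → F))) (restrL (V₂ : Set (B ⊕ C → F))) →
      ∀ (α : A ⊕ B → F) (β : B ⊕ C → F),
        ∃ γ : A ⊕ C → F,
          matched (coset α (V₁ : Set (A ⊕ B → F))) (coset β (V₂ : Set (B ⊕ C → F)))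
            = coset γ (matched (V₁ : Set (A ⊕ B → F)) (V₂ : Set (B ⊕ C → F)))) := by
  refine ⟨⟨fun h α β => h.matched_coset_nonempty α β,
    fun h => fullSumSets_of_matched_coset_nonempty (h 0)⟩, fun h α β => ?_⟩
  obtain ⟨γ, hγ⟩ := h.matched_coset_nonempty α β
  exact ⟨γ, matched_coset_eq_coset hγ⟩

end ILA
end

section
/- Duality of the rigidity properties: Let A, B, C be pairwise disjoint finite sets and let V_AB, V_BC be vector spaces on A⊎B and B⊎C over a field F. Then {V_AB, V_BC} has the zero intersection property if and only if {V_AB⊥, V_BC⊥} has the full sum property, and {V_AB, V_BC} has the full sum property if and only if {V_AB⊥, V_BC⊥} has the zero intersection property. Consequently {V_AB, V_BC} is rigid if and only if {V_AB⊥, V_BC⊥} is rigid. -/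
namespace ILA

variable {F : Type*} [Field F]

/-- The orthogonal complement under the dot product, as a submodule. -/
def dualSubmodule {X : Type*} [Fintype X] (K : Set (X → F)) : Submodule F (X → F) where
  carrier := dualSet K
  zero_mem' := by simp [dualSet]
  add_mem' := by
    intro a b ha hb f hf
    simp [mul_add, Finset.sum_add_distrib, ha f hf, hb f hf]
  smul_mem' := by
    intro c a ha f hf
    simp [mul_left_comm _ c, ← Finset.mul_sum, ha f hf]

lemma coe_dualSubmodule {X : Type*} [Fintype X] (K : Set (X → F)) :
    (dualSubmodule K : Set (X → F)) = dualSet K := rfl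

lemma exists_mem_dualSet_sum_ne_zero {X : Type*} [Fintype X] (W : Submodule F (X → F))
    {x : X → F} (hx : x ∉ W) :
    ∃ g ∈ dualSet (W : Set (X → F)), ∑ i, x i * g i ≠ 0 := by
  classical
  obtain ⟨φ, hφx, hφW⟩ := W.exists_le_ker_of_notMem hx
  have hφ (f : X → F) : φ f = ∑ i, f i * φ (Pi.single i 1) := by
    rw [LinearMap.pi_apply_eq_sum_univ φ f]
    simp only [smul_eq_mul]
    refine Finset.sum_congr rfl fun i _ => ?_
    congr 2
    ext j
    simp [Pi.single_apply, eq_comm]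
  refine ⟨fun i => φ (Pi.single i 1), fun f hf => ?_, ?_⟩
  · rw [← hφ]
    exact hφW hf
  · rwa [← hφ]

lemma dualSet_dualSet {X : Type*} [Fintype X] (W : Submodule F (X → F)) :
    dualSet (dualSet (W : Set (X → F))) = W := by
  ext x
  refine ⟨fun hx => ?_, fun hx g hg => ?_⟩
  · by_contra hxW
    obtain ⟨g, hg, hne⟩ := exists_mem_dualSet_sum_ne_zero W hxW
    exact hne (by simpa only [mul_comm] using hx g hg)
  · simpa only [mul_comm] using hg x hx

lemma eq_top_iff_dualSet_eq {X : Type*} [Fintype X] (W : Submodule F (X → F)) :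
    W = ⊤ ↔ dualSet (W : Set (X → F)) = {0} := by
  classical
  refine ⟨?_, fun h => ?_⟩
  · rintro rfl
    ext g
    refine ⟨fun hg => funext fun i => ?_, ?_⟩
    · simpa [Pi.single_apply] using hg (Pi.single i 1) trivial
    · rintro rfl
      simp [dualSet]
  · refine (Submodule.eq_top_iff').2 fun x => ?_
    by_contra hx
    obtain ⟨g, hg, hne⟩ := exists_mem_dualSet_sum_ne_zero W hx
    rw [h, Set.mem_singleton_iff] at hg
    exact hne (by simp [hg])

lemma coe_map_funLeft_inr {A B : Type*} (V : Submodule F (A ⊕ B → F)) :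
    (V.map (LinearMap.funLeft F F Sum.inr) : Set (B → F)) =
      restrR (V : Set (A ⊕ B → F)) := by
  ext g
  constructor
  · rintro ⟨v, hv, rfl⟩
    refine ⟨v ∘ Sum.inl, ?_⟩
    rwa [show LinearMap.funLeft F F Sum.inr v = v ∘ Sum.inr from rfl, Sum.elim_comp_inl_inr]
  · rintro ⟨f, hf⟩
    exact ⟨_, hf, rfl⟩

lemma coe_map_funLeft_inl {B C : Type*} (V : Submodule F (B ⊕ C → F)) :
    (V.map (LinearMap.funLeft F F Sum.inl) : Set (B → F)) =
      restrL (V : Set (B ⊕ C → F)) := by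
  ext g
  constructor
  · rintro ⟨v, hv, rfl⟩
    refine ⟨v ∘ Sum.inr, ?_⟩
    rwa [show LinearMap.funLeft F F Sum.inl v = v ∘ Sum.inl from rfl, Sum.elim_comp_inl_inr]
  · rintro ⟨f, hf⟩
    exact ⟨_, hf, rfl⟩

lemma fullSumSets_iff_sup_eq_top {Y : Type*} (R L : Submodule F (Y → F)) :
    FullSumSets (R : Set (Y → F)) (L : Set (Y → F)) ↔ R ⊔ L = ⊤ := by
  simp only [FullSumSets, Submodule.eq_top_iff', Submodule.mem_sup, SetLike.mem_coe, eq_comm]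

lemma dualSet_sup {X : Type*} [Fintype X] (R L : Submodule F (X → F)) :
    dualSet ((R ⊔ L : Submodule F (X → F)) : Set (X → F)) =
      dualSet (R : Set (X → F)) ∩ dualSet (L : Set (X → F)) := by
  ext g
  refine ⟨fun hg => ⟨fun f hf => hg f (Submodule.mem_sup_left hf),
    fun f hf => hg f (Submodule.mem_sup_right hf)⟩, ?_⟩
  rintro ⟨hR, hL⟩ f hf
  obtain ⟨u, hu, v, hv, rfl⟩ := Submodule.mem_sup.1 hf
  simp [add_mul, Finset.sum_add_distrib, hR u hu, hL v hv]

lemma dualSet_restrR {A B : Type*} [Fintype A] [Fintype B] (K : Set (A ⊕ B → F)) :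
    dualSet (restrR K) = contrR (dualSet K) := by
  ext g
  constructor
  · intro hg v hv
    have := hg (v ∘ Sum.inr) ⟨v ∘ Sum.inl, by rwa [Sum.elim_comp_inl_inr]⟩
    simpa using this
  · rintro hg f ⟨e, he⟩
    simpa using hg _ he

lemma dualSet_restrL {B C : Type*} [Fintype B] [Fintype C] (K : Set (B ⊕ C → F)) :
    dualSet (restrL K) = contrL (dualSet K) := by
  ext g
  constructor
  · intro hg v hv
    have := hg (v ∘ Sum.inl) ⟨v ∘ Sum.inr, by rwa [Sum.elim_comp_inl_inr]⟩
    simpa using this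
  · rintro hg f ⟨e, he⟩
    simpa using hg _ he

lemma fullSumSets_iff_contr_dualSet_inter_eq {A B C : Type*} [Fintype A] [Fintype B] [Fintype C]
    (V₁ : Submodule F (A ⊕ B → F)) (V₂ : Submodule F (B ⊕ C → F)) :
    FullSumSets (restrR (V₁ : Set (A ⊕ B → F))) (restrL (V₂ : Set (B ⊕ C → F))) ↔
      contrR (dualSet (V₁ : Set (A ⊕ B → F)))
        ∩ contrL (dualSet (V₂ : Set (B ⊕ C → F))) = {0} := by
  rw [← dualSet_restrR, ← dualSet_restrL, ← coe_map_funLeft_inr, ← coe_map_funLeft_inl,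
    fullSumSets_iff_sup_eq_top, eq_top_iff_dualSet_eq, dualSet_sup]

/-- **Duality of the rigidity properties.** `{V₁, V₂}` has the zero intersection (full sum)
property iff `{V₁⊥, V₂⊥}` has the full sum (zero intersection) property; hence `{V₁, V₂}`
is rigid iff `{V₁⊥, V₂⊥}` is rigid. -/
theorem rigidity_duality {A B C : Type*} [Fintype A] [Fintype B] [Fintype C]
    (V₁ : Submodule F (A ⊕ B → F)) (V₂ : Submodule F (B ⊕ C → F)) :
    (contrR (V₁ : Set (A ⊕ B → F)) ∩ contrL (V₂ : Set (B ⊕ C → F)) = {0} ↔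
      FullSumSets (restrR (dualSet (V₁ : Set (A ⊕ B → F))))
        (restrL (dualSet (V₂ : Set (B ⊕ C → F))))) ∧
    (FullSumSets (restrR (V₁ : Set (A ⊕ B → F))) (restrL (V₂ : Set (B ⊕ C → F))) ↔
      contrR (dualSet (V₁ : Set (A ⊕ B → F)))
        ∩ contrL (dualSet (V₂ : Set (B ⊕ C → F))) = {0}) ∧
    ((FullSumSets (restrR (V₁ : Set (A ⊕ B → F))) (restrL (V₂ : Set (B ⊕ C → F))) ∧
        contrR (V₁ : Set (A ⊕ B → F)) ∩ contrL (V₂ : Set (B ⊕ C → F)) = {0}) ↔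
      (FullSumSets (restrR (dualSet (V₁ : Set (A ⊕ B → F))))
          (restrL (dualSet (V₂ : Set (B ⊕ C → F)))) ∧
        contrR (dualSet (V₁ : Set (A ⊕ B → F)))
          ∩ contrL (dualSet (V₂ : Set (B ⊕ C → F))) = {0})) := by
  have hfull := fullSumSets_iff_contr_dualSet_inter_eq V₁ V₂
  have hzero := fullSumSets_iff_contr_dualSet_inter_eq
    (dualSubmodule (V₁ : Set (A ⊕ B → F))) (dualSubmodule (V₂ : Set (B ⊕ C → F)))
  simp only [coe_dualSubmodule, dualSet_dualSet] at hzero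
  exact ⟨hzero.symm, hfull, by rw [hfull, hzero, and_comm]⟩

end ILA
end

section
/- Let A, B, C be pairwise disjoint finite sets and let V_AB, V_BC be vector spaces on A⊎B and B⊎C over a field F. If the pair {V_AB, V_BC} is rigid, then r(V_AB ↔ V_BC) = r(V_AB) + r(V_BC) − |B|. -/
namespace ILA

variable {F : Type*} [Field F]

/-- The mismatch on the common component `P` of a vector on `S ⊎ P` and one on `P ⊎ Q`. -/
def matchGap {S P Q : Type*} : ((S ⊕ P → F) × (P ⊕ Q → F)) →ₗ[F] (P → F) :=
  LinearMap.funLeft F F Sum.inr ∘ₗ LinearMap.fst F _ _ -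
    LinearMap.funLeft F F Sum.inl ∘ₗ LinearMap.snd F _ _

/-- The outer components, on `S ⊎ Q`, of a vector on `S ⊎ P` and one on `P ⊎ Q`. -/
def matchEnds {S P Q : Type*} : ((S ⊕ P → F) × (P ⊕ Q → F)) →ₗ[F] (S ⊕ Q → F) where
  toFun v := Sum.elim (v.1 ∘ Sum.inl) (v.2 ∘ Sum.inr)
  map_add' v w := by ext (x | x) <;> rfl
  map_smul' c v := by ext (x | x) <;> rfl

theorem mem_ker_matchGap {S P Q : Type*} {v : (S ⊕ P → F) × (P ⊕ Q → F)} :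
    v ∈ LinearMap.ker (matchGap (F := F)) ↔ v.1 ∘ Sum.inr = v.2 ∘ Sum.inl :=
  LinearMap.mem_ker.trans sub_eq_zero

/-- The matched composition of two subspaces is the space of outer components of the pairs
that agree on the common component. -/
theorem matched_eq_map {S P Q : Type*} (V₁ : Submodule F (S ⊕ P → F))
    (V₂ : Submodule F (P ⊕ Q → F)) :
    matched (V₁ : Set (S ⊕ P → F)) (V₂ : Set (P ⊕ Q → F)) =
      (V₁.prod V₂ ⊓ LinearMap.ker matchGap).map matchEnds := by
  ext h
  constructor
  · rintro ⟨p, h₁, h₂⟩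
    exact ⟨(Sum.elim (h ∘ Sum.inl) p, Sum.elim p (h ∘ Sum.inr)),
      ⟨⟨h₁, h₂⟩, mem_ker_matchGap.2 rfl⟩, Sum.elim_comp_inl_inr h⟩
  · rintro ⟨⟨v, w⟩, ⟨⟨hv, hw⟩, hvw⟩, rfl⟩
    have hp : v ∘ Sum.inr = w ∘ Sum.inl := mem_ker_matchGap.1 hvw
    refine ⟨v ∘ Sum.inr, ?_, ?_⟩
    · change Sum.elim (v ∘ Sum.inl) (v ∘ Sum.inr) ∈ V₁
      rwa [Sum.elim_comp_inl_inr]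
    · change Sum.elim (v ∘ Sum.inr) (w ∘ Sum.inr) ∈ V₂
      rwa [hp, Sum.elim_comp_inl_inr]

theorem map_matchGap_eq_top {S P Q : Type*} {V₁ : Submodule F (S ⊕ P → F)}
    {V₂ : Submodule F (P ⊕ Q → F)}
    (hfs : FullSumSets (restrR (V₁ : Set (S ⊕ P → F))) (restrL (V₂ : Set (P ⊕ Q → F)))) :
    (V₁.prod V₂).map matchGap = ⊤ := by
  refine eq_top_iff.2 fun p _ => ?_
  obtain ⟨u, ⟨f, hf⟩, v, ⟨g, hg⟩, rfl⟩ := hfs p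
  refine ⟨(Sum.elim f u, -Sum.elim v g), ⟨hf, V₂.neg_mem hg⟩, ?_⟩
  change u - -v = u + v
  exact sub_neg_eq_add u v

theorem disjoint_ker_matchEnds {S P Q : Type*} {V₁ : Submodule F (S ⊕ P → F)}
    {V₂ : Submodule F (P ⊕ Q → F)}
    (hzi : contrR (V₁ : Set (S ⊕ P → F)) ∩ contrL (V₂ : Set (P ⊕ Q → F)) = {0}) :
    Disjoint (V₁.prod V₂ ⊓ LinearMap.ker matchGap) (LinearMap.ker matchEnds) := by
  refine Submodule.disjoint_def.2 ?_
  rintro ⟨v, w⟩ ⟨⟨hv, hw⟩, hvw⟩ hends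
  have hp : v ∘ Sum.inr = w ∘ Sum.inl := mem_ker_matchGap.1 hvw
  have hv₀ : v ∘ Sum.inl = 0 := congrArg (· ∘ Sum.inl) (LinearMap.mem_ker.1 hends)
  have hw₀ : w ∘ Sum.inr = 0 := congrArg (· ∘ Sum.inr) (LinearMap.mem_ker.1 hends)
  have hv' : v = Sum.elim (0 : S → F) (v ∘ Sum.inr) := by rw [← hv₀, Sum.elim_comp_inl_inr]
  have hw' : w = Sum.elim (v ∘ Sum.inr) (0 : Q → F) := by rw [← hw₀, hp, Sum.elim_comp_inl_inr]
  have hmem : v ∘ Sum.inr ∈ contrR (V₁ : Set (S ⊕ P → F)) ∩ contrL (V₂ : Set (P ⊕ Q → F)) :=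
    ⟨hv'.subst (motive := (· ∈ V₁)) hv, hw'.subst (motive := (· ∈ V₂)) hw⟩
  rw [hzi, Set.mem_singleton_iff] at hmem
  rw [hv', hw', hmem, Sum.elim_zero_zero, Sum.elim_zero_zero, Prod.mk_zero_zero]

theorem finrank_map_add_finrank_inf_ker {M N : Type*} [AddCommGroup M] [Module F M]
    [AddCommGroup N] [Module F N] (f : M →ₗ[F] N) (W : Submodule F M) [FiniteDimensional F W] :
    Module.finrank F (W.map f) + Module.finrank F ↥(W ⊓ LinearMap.ker f) =
      Module.finrank F W := by
  have h := (f.domRestrict W).finrank_range_add_finrank_ker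
  rw [LinearMap.range_domRestrict, LinearMap.ker_domRestrict] at h
  rw [← h, ← Submodule.map_comap_subtype, Submodule.finrank_map_subtype_eq]

theorem finrank_submodule_prod {M N : Type*} [AddCommGroup M] [Module F M] [AddCommGroup N]
    [Module F N] (V : Submodule F M) (W : Submodule F N) [FiniteDimensional F V]
    [FiniteDimensional F W] :
    Module.finrank F ↥(V.prod W) = Module.finrank F V + Module.finrank F W := by
  have e : ↥(V.prod W) ≃ₗ[F] V × W :=
    { toFun := fun v => (⟨v.1.1, v.2.1⟩, ⟨v.1.2, v.2.2⟩)
      invFun := fun v => ⟨(v.1, v.2), v.1.2, v.2.2⟩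
      map_add' := fun _ _ => rfl
      map_smul' := fun _ _ => rfl
      left_inv := fun _ => rfl
      right_inv := fun _ => rfl }
  rw [e.finrank_eq, Module.finrank_prod]

/-- If `{V₁, V₂}` is rigid then `r(V₁ ↔ V₂) = r(V₁) + r(V₂) − |B|`. -/
theorem rigid_rank_matched {A B C : Type*} [Fintype A] [Fintype B] [Fintype C]
    (V₁ : Submodule F (A ⊕ B → F)) (V₂ : Submodule F (B ⊕ C → F))
    (hfs : FullSumSets (restrR (V₁ : Set (A ⊕ B → F))) (restrL (V₂ : Set (B ⊕ C → F))))
    (hzi : contrR (V₁ : Set (A ⊕ B → F)) ∩ contrL (V₂ : Set (B ⊕ C → F)) = {0}) :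
    (rk (matched (V₁ : Set (A ⊕ B → F)) (V₂ : Set (B ⊕ C → F))) : ℤ)
      = (Module.finrank F V₁ : ℤ) + (Module.finrank F V₂ : ℤ) - (Fintype.card B : ℤ) := by
  have hgap := finrank_map_add_finrank_inf_ker matchGap (V₁.prod V₂)
  rw [map_matchGap_eq_top hfs, finrank_top, Module.finrank_fintype_fun_eq_card,
    finrank_submodule_prod] at hgap
  have hends := finrank_map_add_finrank_inf_ker matchEnds
    (V₁.prod V₂ ⊓ LinearMap.ker matchGap)
  rw [(disjoint_ker_matchEnds hzi).eq_bot, finrank_bot, add_zero] at hends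
  rw [rk, matched_eq_map, Submodule.span_eq, hends]
  omega

end ILA
end

section
/- Let W, T, V be pairwise disjoint finite sets and let V_WTV, V_T, V_V be vector spaces on W⊎T⊎V, T, and V respectively over a field F. Then {V_WTV, V_T ⊕ V_V} is rigid if and only if both {V_WTV, V_V} and {V_WTV ↔ V_V, V_T} are rigid. Here V_T ⊕ V_V is the direct sum on T⊎V, the pair {V_WTV, V_T⊕V_V} is taken with respect to the split W versus T⊎V, the pair {V_WTV, V_V} with respect to the split W⊎T versus V, and V_WTV ↔ V_V is a vector space on W⊎T paired with V_T with respect to the split W versus T. -/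
namespace ILA

variable {F : Type*} [Field F]

theorem elim₃_add_mem {W T V : Type*} {K : Submodule F (W ⊕ (T ⊕ V) → F)}
    {w w' : W → F} {t t' : T → F} {v v' : V → F}
    (h : Sum.elim w (Sum.elim t v) ∈ K) (h' : Sum.elim w' (Sum.elim t' v') ∈ K) :
    Sum.elim (w + w') (Sum.elim (t + t') (v + v')) ∈ K := by
  have e : Sum.elim (w + w') (Sum.elim (t + t') (v + v')) =
      Sum.elim w (Sum.elim t v) + Sum.elim w' (Sum.elim t' v') := by
    ext (_ | _ | _) <;> rfl
  exact e ▸ K.add_mem h h'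

theorem elim₃_zero_mem {W T V : Type*} (K : Submodule F (W ⊕ (T ⊕ V) → F)) :
    Sum.elim (0 : W → F) (Sum.elim (0 : T → F) (0 : V → F)) ∈ K := by
  have e : Sum.elim (0 : W → F) (Sum.elim (0 : T → F) (0 : V → F)) = 0 := by
    ext (_ | _ | _) <;> rfl
  exact e ▸ K.zero_mem

theorem fullSum_dsum_iff {W T V : Type*} (K : Submodule F (W ⊕ (T ⊕ V) → F))
    (Vt : Submodule F (T → F)) (Vv : Submodule F (V → F)) :
    FullSumSets (restrR (K : Set (W ⊕ (T ⊕ V) → F)))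
        (dsum (Vt : Set (T → F)) (Vv : Set (V → F))) ↔
      FullSumSets (restrR (restrR (K : Set (W ⊕ (T ⊕ V) → F)))) (Vv : Set (V → F)) ∧
        FullSumSets
          (restrR (matchedTriple (K : Set (W ⊕ (T ⊕ V) → F)) (Vv : Set (V → F))))
          (Vt : Set (T → F)) := by
  constructor
  · refine fun h => ⟨fun v => ?_, fun t => ?_⟩
    · obtain ⟨u, ⟨w, hu⟩, y, ⟨-, hy⟩, e⟩ := h (Sum.elim 0 v)
      refine ⟨u ∘ Sum.inr, ⟨u ∘ Sum.inl, w, ?_⟩, y ∘ Sum.inr, hy, ?_⟩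
      · rwa [Sum.elim_comp_inl_inr]
      · exact congrArg (· ∘ Sum.inr) e
    · obtain ⟨u, ⟨w, hu⟩, y, ⟨hy, hy'⟩, e⟩ := h (Sum.elim t 0)
      have e' : (0 : V → F) = u ∘ Sum.inr + y ∘ Sum.inr := congrArg (· ∘ Sum.inr) e
      refine ⟨u ∘ Sum.inl, ⟨w, u ∘ Sum.inr, ?_, ?_⟩, y ∘ Sum.inl, hy,
        congrArg (· ∘ Sum.inl) e⟩
      · rw [eq_neg_of_add_eq_zero_left e'.symm]
        exact Vv.neg_mem hy'
      · change Sum.elim w (Sum.elim (u ∘ Sum.inl) (u ∘ Sum.inr)) ∈ K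
        rwa [Sum.elim_comp_inl_inr]
  · rintro ⟨hV, hT⟩ h
    obtain ⟨v₀, ⟨t₀, w₀, h₀⟩, v₂, hv₂, ev⟩ := hV (h ∘ Sum.inr)
    obtain ⟨t₁, ⟨w₁, v₁, hv₁, h₁⟩, t₂, ht₂, et⟩ := hT (h ∘ Sum.inl - t₀)
    refine ⟨Sum.elim (t₀ + t₁) (v₀ + v₁), ⟨w₀ + w₁, elim₃_add_mem h₀ h₁⟩,
      Sum.elim t₂ (v₂ - v₁), ⟨ht₂, Vv.sub_mem hv₂ hv₁⟩, ?_⟩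
    ext (x | x)
    · have := congrFun et x
      simp only [Pi.sub_apply, Pi.add_apply, Function.comp_apply, Sum.elim_inl] at this ⊢
      linear_combination this
    · have := congrFun ev x
      simp only [Pi.sub_apply, Pi.add_apply, Function.comp_apply, Sum.elim_inr] at this ⊢
      linear_combination this

theorem contrR_inter_dsum_eq_zero_iff {W T V : Type*} (K : Submodule F (W ⊕ (T ⊕ V) → F))
    (Vt : Submodule F (T → F)) (Vv : Submodule F (V → F)) :
    contrR (K : Set (W ⊕ (T ⊕ V) → F)) ∩ dsum (Vt : Set (T → F)) (Vv : Set (V → F)) = {0} ↔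
      contrR (contrR (K : Set (W ⊕ (T ⊕ V) → F))) ∩ (Vv : Set (V → F)) = {0} ∧
        contrR (matchedTriple (K : Set (W ⊕ (T ⊕ V) → F)) (Vv : Set (V → F)))
          ∩ (Vt : Set (T → F)) = {0} := by
  have hK := elim₃_zero_mem K
  simp only [Set.eq_singleton_iff_unique_mem]
  constructor
  · rintro ⟨-, h⟩
    refine ⟨⟨⟨hK, Vv.zero_mem⟩, fun v hv => ?_⟩,
      ⟨⟨⟨0, Vv.zero_mem, hK⟩, Vt.zero_mem⟩, ?_⟩⟩
    · exact congrArg (· ∘ Sum.inr) (h (Sum.elim 0 v) ⟨hv.1, Vt.zero_mem, hv.2⟩)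
    · rintro t ⟨⟨v, hv, hK'⟩, ht⟩
      exact congrArg (· ∘ Sum.inl) (h (Sum.elim t v) ⟨hK', ht, hv⟩)
  · rintro ⟨⟨-, hV⟩, -, hT⟩
    have e : Sum.elim (0 : T → F) (0 : V → F) = 0 := by ext (_ | _) <;> rfl
    refine ⟨⟨e ▸ hK, Vt.zero_mem, Vv.zero_mem⟩, ?_⟩
    rintro h ⟨hc, ht, hv⟩
    rw [← Sum.elim_comp_inl_inr h] at hc ⊢
    have t0 := hT (h ∘ Sum.inl) ⟨⟨h ∘ Sum.inr, hv, hc⟩, ht⟩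
    rw [t0] at hc ⊢
    rw [hV (h ∘ Sum.inr) ⟨hc, hv⟩, e]

/-- `{V_WTV, V_T ⊕ V_V}` is rigid iff `{V_WTV, V_V}` and `{V_WTV ↔ V_V, V_T}` are rigid. -/
theorem rigid_decomposition_matched {W T V : Type*} [Fintype W] [Fintype T] [Fintype V]
    (Vwtv : Submodule F (W ⊕ (T ⊕ V) → F))
    (Vt : Submodule F (T → F)) (Vv : Submodule F (V → F)) :
    (FullSumSets (restrR (Vwtv : Set (W ⊕ (T ⊕ V) → F)))
        (dsum (Vt : Set (T → F)) (Vv : Set (V → F))) ∧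
      contrR (Vwtv : Set (W ⊕ (T ⊕ V) → F))
        ∩ dsum (Vt : Set (T → F)) (Vv : Set (V → F)) = {0}) ↔
    ((FullSumSets (restrR (restrR (Vwtv : Set (W ⊕ (T ⊕ V) → F)))) (Vv : Set (V → F)) ∧
        contrR (contrR (Vwtv : Set (W ⊕ (T ⊕ V) → F))) ∩ (Vv : Set (V → F)) = {0}) ∧
     (FullSumSets
          (restrR (matchedTriple (Vwtv : Set (W ⊕ (T ⊕ V) → F)) (Vv : Set (V → F))))
          (Vt : Set (T → F)) ∧
        contrR (matchedTriple (Vwtv : Set (W ⊕ (T ⊕ V) → F)) (Vv : Set (V → F)))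
          ∩ (Vt : Set (T → F)) = {0})) := by
  rw [fullSum_dsum_iff, contrR_inter_dsum_eq_zero_iff]
  exact and_and_and_comm

end ILA
end
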